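/- Let k be an algebraically closed field of characteristic 2, F = k(x,y) the rational function field in two variables, a = x and b = x⁻²y⁻¹ + 1. Then the separable biquadratic extension F(℘⁻¹(a), ℘⁻¹(b)) of F is not excellent. -/

import Mathlib

open scoped TensorProduct

namespace BL

/-! ### Quadratic forms over a field, presented by matrices -/

/-- A quadratic form over `F` given by a square matrix `M` of size `n`:
the form is `v ↦ vᵀ M v`. Every quadratic form on a finite-dimensional
`F`-vector space is isometric to one of this shape. -/
structure QF (F : Type) [Field F] : Type where
  n : ℕ
  M : Matrix (Fin n) (Fin n) F

namespace QF

variable {F K : Type} [Field F] [Field K]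

/-- The quadratic form associated to the presentation. -/
noncomputable def form (q : QF F) : QuadraticForm F (Fin q.n → F) :=
  q.M.toQuadraticMap'

/-- Isometry of quadratic forms. -/
def Isom (p q : QF F) : Prop :=
  QuadraticMap.Equivalent p.form q.form

/-- Orthogonal sum. -/
def oplus (p q : QF F) : QF F :=
  ⟨p.n + q.n, Matrix.reindex finSumFinEquiv finSumFinEquiv (Matrix.fromBlocks p.M 0 0 q.M)⟩

/-- Scaling a quadratic form by a scalar. -/
def sm (c : F) (q : QF F) : QF F := ⟨q.n, c • q.M⟩

/-- The zero-dimensional quadratic form. -/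
def nil : QF F := ⟨0, 0⟩

/-- The binary quadratic form `[a, b] : (x, y) ↦ a x² + x y + b y²`. -/
def bin (a b : F) : QF F := ⟨2, !![a, 1; 0, b]⟩

/-- Orthogonal sum of a list of forms. -/
def sumList : List (QF F) → QF F := fun L => L.foldr oplus nil

/-- Orthogonal sum of a finite family of forms. -/
def sumFin {r : ℕ} (f : Fin r → QF F) : QF F := sumList (List.ofFn f)

/-- `hypN k` is an orthogonal sum of `k` hyperbolic planes `[0,0]`. -/
def hypN (k : ℕ) : QF F := sumList (List.replicate k (bin 0 0))

/-- `zeroN j` is `j × ⟨0⟩`, the totally singular zero form of dimension `j`. -/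
def zeroN (j : ℕ) : QF F := ⟨j, 0⟩

/-- The quadratic Pfister form `⟨⟨a₁, …, a_r⟩⟩_b ⊗ [1, b]`
(an `(r+1)`-fold quadratic Pfister form). -/
def qpf : List F → F → QF F
  | [], b => bin 1 b
  | a :: l, b => oplus (qpf l b) (sm a (qpf l b))

/-- A form is hyperbolic if it is isometric to a sum of hyperbolic planes. -/
def Hyperbolic (q : QF F) : Prop := ∃ k, Isom q (hypN k)

/-- Witt equivalence of quadratic forms. -/
def WittEquiv (p q : QF F) : Prop :=
  ∃ k l, Isom (oplus p (hypN k)) (oplus q (hypN l))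

/-- The Witt class of `q` is trivial. -/
def WittZero (q : QF F) : Prop := WittEquiv q nil

/-- A (matrix-presented) quadratic form is nonsingular iff its polar bilinear
form, with matrix `M + Mᵀ`, is nondegenerate. -/
def Nonsingular (q : QF F) : Prop := IsUnit (q.M + q.M.transpose)

/-- `ψ` is the anisotropic part of `q`: `ψ` is anisotropic and
`q ≅ ψ ⊥ i × [0,0] ⊥ j × ⟨0⟩` (Witt decomposition). -/
def IsAnisoPartOf (q ψ : QF F) : Prop :=
  ψ.form.Anisotropic ∧ ∃ i j, Isom q (oplus ψ (oplus (hypN i) (zeroN j)))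

/-- Transport of a quadratic form along a ring homomorphism. -/
def map (f : F →+* K) (q : QF F) : QF K := ⟨q.n, q.M.map f⟩

/-- Extension of scalars of a quadratic form to a field extension `K / F`. -/
def bc (K : Type) [Field K] [Algebra F K] (q : QF F) : QF K :=
  q.map (algebraMap F K)

/-- Membership in `I^m_q F`, the `(m-1)`-st power of the fundamental ideal times
the Witt group of quadratic forms: `q ∈ I^m_q F` iff `q` is Witt equivalent to a sum of
scaled `m`-fold quadratic Pfister forms `c • ⟨⟨a₁, …, a_{m-1}⟩⟩ ⊗ [1, b]`. -/
def InIq (m : ℕ) (q : QF F) : Prop :=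
  ∃ L : List (F × List F × F), (∀ t ∈ L, t.2.1.length + 1 = m) ∧
    WittEquiv q (sumList (L.map fun t => sm t.1 (qpf t.2.1 t.2.2)))

/-- Membership in `I^m F ⊗ [1, a] ⊆ I^{m+1}_q F`, the subgroup additively generated by the
forms `c • ⟨⟨a₁, …, a_m⟩⟩_b ⊗ [1, a]`. -/
def InImTimes (m : ℕ) (a : F) (q : QF F) : Prop :=
  ∃ L : List (F × List F), (∀ t ∈ L, t.2.length = m) ∧
    WittEquiv q (sumList (L.map fun t => sm t.1 (qpf t.2 a)))

/-- Membership in `W(F) ⊗ [1, a]`, the subgroup additively generated by the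
forms `c • [1, a]`. -/
def InWTimes (a : F) (q : QF F) : Prop :=
  ∃ L : List F, WittEquiv q (sumList (L.map fun c => sm c (bin 1 a)))

end QF

/-- `I^m_q F = 0`. -/
def IqZero (F : Type) [Field F] (m : ℕ) : Prop :=
  ∀ q : QF F, QF.InIq m q → QF.WittZero q

/-- `cd₂(F) ≤ c`: for every finite field extension `L/F` and every `m ≥ c` one has
`I^{m+1}_q L = 0` (this is the characterization of the `2`-cohomological dimension via
Kato's isomorphism `H^{m+1,m}(L, ℤ/2) ≅ Ī^{m+1}_q L` and the Arason–Pfister Hauptsatz). -/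
def Cd2Le (F : Type) [Field F] (c : ℕ) : Prop :=
  ∀ (L : Type) (_ : Field L) (_ : Algebra F L), FiniteDimensional F L →
    ∀ m : ℕ, c ≤ m → IqZero L (m + 1)

/-- `cd₂ F = c`. -/
def Cd2Eq (F : Type) [Field F] (c : ℕ) : Prop :=
  Cd2Le F c ∧ ∀ d : ℕ, Cd2Le F d → c ≤ d

/-- An extension `K/F` is excellent if the anisotropic part of the extension to `K`
of any anisotropic `F`-form is defined over `F`. -/
def Excellent (F K : Type) [Field F] [Field K] [Algebra F K] : Prop :=
  ∀ φ : QF F, φ.form.Anisotropic → ∃ ψ : QF F, QF.IsAnisoPartOf (φ.bc K) (ψ.bc K)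

/-- `K/F` is excellent for the forms of `I²_q F`, i.e. `K/F ∈ E₂(F)`. -/
def ExcellentI2 (F K : Type) [Field F] [Field K] [Algebra F K] : Prop :=
  ∀ φ : QF F, QF.InIq 2 φ → φ.form.Anisotropic →
    ∃ ψ : QF F, QF.InIq 2 ψ ∧ QF.IsAnisoPartOf (φ.bc K) (ψ.bc K)

/-- `K/F` is a multiquadratic extension: a compositum of finitely many quadratic
extensions of `F`. -/
def IsMultiquadratic (F K : Type) [Field F] [Field K] [Algebra F K] : Prop :=
  ∃ (r : ℕ) (E : Fin r → IntermediateField F K),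
    (∀ i, Module.finrank F (E i) = 2) ∧ (⨆ i, E i) = ⊤



/-! ### Central simple algebras, quaternion algebras in characteristic 2 -/

/-- A bundled (possibly noncommutative) `F`-algebra. -/
structure FAlg (F : Type) [Field F] : Type 1 where
  carrier : Type
  [ring : Ring carrier]
  [alg : Algebra F carrier]

attribute [instance] FAlg.ring FAlg.alg

instance {F : Type} [Field F] : CoeSort (FAlg F) Type := ⟨FAlg.carrier⟩

variable (F : Type) [Field F]

/-- The defining relations of the quaternion algebra `[α, β)` in characteristic 2:
generators `i = ι 0`, `j = ι 1` with `i² + i = α`, `j² = β`, `ji = ij + j`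
(the last being equivalent to `j i j⁻¹ = i + 1`). -/
inductive QuatRel (α β : F) : FreeAlgebra F (Fin 2) → FreeAlgebra F (Fin 2) → Prop
  | i_sq : QuatRel α β (FreeAlgebra.ι F 0 * FreeAlgebra.ι F 0 + FreeAlgebra.ι F 0)
      (algebraMap F _ α)
  | j_sq : QuatRel α β (FreeAlgebra.ι F 1 * FreeAlgebra.ι F 1) (algebraMap F _ β)
  | comm : QuatRel α β (FreeAlgebra.ι F 1 * FreeAlgebra.ι F 0)
      (FreeAlgebra.ι F 0 * FreeAlgebra.ι F 1 + FreeAlgebra.ι F 1)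

/-- The quaternion `F`-algebra `[α, β) = F⟨i, j : i² + i = α, j² = β, jij⁻¹ = i + 1⟩`
(characteristic 2). -/
def QuatAlg (α β : F) : Type := RingQuot (QuatRel F α β)

noncomputable instance (α β : F) : Ring (QuatAlg F α β) :=
  inferInstanceAs (Ring (RingQuot (QuatRel F α β)))

noncomputable instance (α β : F) : Algebra F (QuatAlg F α β) :=
  inferInstanceAs (Algebra F (RingQuot (QuatRel F α β)))

variable (A : Type) [Ring A] [Algebra F A]

/-- An `F`-algebra is split if it is isomorphic to a matrix algebra over `F`. -/
def IsSplit : Prop :=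
  ∃ m : ℕ, 0 < m ∧ Nonempty (A ≃ₐ[F] Matrix (Fin m) (Fin m) F)

/-- A central simple `F`-algebra has exponent 2 if its Brauer class has order exactly 2:
`A ⊗ A` is split but `A` is not. -/
def HasExponentTwo : Prop :=
  IsSplit F (A ⊗[F] A) ∧ ¬ IsSplit F A

/-- The index of a central simple `F`-algebra `A` is `d` if `A ≅ M_m(D)` for a
division `F`-algebra `D` of degree `d` (i.e. of dimension `d²`). -/
def HasIndex (d : ℕ) : Prop :=
  ∃ D : FAlg F, (∀ x : D.carrier, x ≠ 0 → IsUnit x) ∧ Nontrivial D.carrier ∧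
    Module.finrank F D.carrier = d ^ 2 ∧
    ∃ m : ℕ, 0 < m ∧ Nonempty (A ≃ₐ[F] Matrix (Fin m) (Fin m) D.carrier)

/-- `A` is a central division `F`-algebra of degree `2 ^ n`. -/
def IsCentralDivisionOfDegree (n : ℕ) : Prop :=
  Algebra.IsCentral F A ∧ Nontrivial A ∧ (∀ x : A, x ≠ 0 → IsUnit x) ∧
    Module.finrank F A = (2 ^ n) ^ 2

/-- `A` is a central simple `F`-algebra of degree `2 ^ n`. -/
def IsCSAOfDegree (n : ℕ) : Prop :=
  Algebra.IsCentral F A ∧ IsSimpleRing A ∧ Module.finrank F A = (2 ^ n) ^ 2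

variable (K : Type) [Field K] [Algebra F K]

/-- `A` admits a decomposition adapted to the multiquadratic extension `K/F`:
there are quadratic extensions `E₁, …, E_r` of `F` inside `K` with
`K = E₁ ⋯ E_r ≅ E₁ ⊗ ⋯ ⊗ E_r` (so `[K : F] = 2^r`), quaternion `F`-algebras
`Q_i = [αᵢ, βᵢ)` with `Eᵢ ⊂ Qᵢ`, and an algebra `A'` with `A ≅ Q₁ ⊗ ⋯ ⊗ Q_r ⊗ A'`. -/
def AdaptedDecomp : Prop :=
  ∃ (r : ℕ) (E : Fin r → IntermediateField F K) (α β : Fin r → F),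
    (∀ i, Module.finrank F (E i) = 2) ∧ (⨆ i, E i) = ⊤ ∧
    Module.finrank F K = 2 ^ r ∧
    (∀ i, β i ≠ 0) ∧
    (∀ i, Nonempty ((E i) →ₐ[F] QuatAlg F (α i) (β i))) ∧
    ∃ A' : FAlg F, Nonempty (A ≃ₐ[F] ((⨂[F] i, QuatAlg F (α i) (β i)) ⊗[F] A'.carrier))

/-- The rational function field `k(x, y)` in two variables, realized as `k(x)(y)`. -/
abbrev RatFunc2 (k : Type) [Field k] : Type := RatFunc (RatFunc k)

/-- The variable `x` of `k(x, y)`. -/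
noncomputable def xV (k : Type) [Field k] : RatFunc2 k := RatFunc.C RatFunc.X

/-- The variable `y` of `k(x, y)`. -/
noncomputable def yV (k : Type) [Field k] : RatFunc2 k := RatFunc.X

/-- The element `b = x⁻²y⁻¹ + 1` of `k(x, y)`. -/
noncomputable def bV (k : Type) [Field k] : RatFunc2 k := xV k ^ (-2 : ℤ) * (yV k)⁻¹ + 1

/-- The element `c = x⁻³(y⁻² + xy⁻¹ + x³)` of `k(x, y)`. -/
noncomputable def cV (k : Type) [Field k] : RatFunc2 k :=
  xV k ^ (-3 : ℤ) * (yV k ^ (-2 : ℤ) + xV k * (yV k)⁻¹ + xV k ^ 3)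

/-! ### Helper material: a rank two valuation -/

/-- A `ℤ × ℤ` (lexicographic) valued valuation, given by its two components. -/
structure Val2 (E : Type) [Field E] where
  d1 : E → ℤ
  d2 : E → ℤ
  mul1 : ∀ x y, x ≠ 0 → y ≠ 0 → d1 (x * y) = d1 x + d1 y
  mul2 : ∀ x y, x ≠ 0 → y ≠ 0 → d2 (x * y) = d2 x + d2 y
  add : ∀ x y, x ≠ 0 → y ≠ 0 → (d1 x < d1 y ∨ (d1 x = d1 y ∧ d2 x < d2 y)) →
    x + y ≠ 0 ∧ d1 (x + y) = d1 x ∧ d2 (x + y) = d2 x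

namespace Val2

/-- Restriction of a valuation along a ring homomorphism. -/
def comap {E E' : Type} [Field E] [Field E'] (w : Val2 E') (f : E →+* E') : Val2 E where
  d1 x := w.d1 (f x)
  d2 x := w.d2 (f x)
  mul1 x y hx hy := by
    rw [map_mul]; exact w.mul1 _ _ (by simpa using hx) (by simpa using hy)
  mul2 x y hx hy := by
    rw [map_mul]; exact w.mul2 _ _ (by simpa using hx) (by simpa using hy)
  add x y hx hy h := by
    have := w.add (f x) (f y) (by simpa using hx) (by simpa using hy) h
    rw [← map_add] at this
    exact ⟨fun h0 => this.1 (by rw [h0, map_zero]), this.2⟩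

section
variable {E : Type} [Field E] (w : Val2 E)

lemma one1 : w.d1 1 = 0 := by
  have := w.mul1 1 1 one_ne_zero one_ne_zero
  rw [mul_one] at this; omega

lemma one2 : w.d2 1 = 0 := by
  have := w.mul2 1 1 one_ne_zero one_ne_zero
  rw [mul_one] at this; omega

lemma inv1 (x : E) (hx : x ≠ 0) : w.d1 x⁻¹ = - w.d1 x := by
  have := w.mul1 x x⁻¹ hx (inv_ne_zero hx)
  rw [mul_inv_cancel₀ hx, one1] at this; omega

lemma inv2 (x : E) (hx : x ≠ 0) : w.d2 x⁻¹ = - w.d2 x := by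
  have := w.mul2 x x⁻¹ hx (inv_ne_zero hx)
  rw [mul_inv_cancel₀ hx, one2] at this; omega

lemma pow1 (x : E) (hx : x ≠ 0) (n : ℕ) : w.d1 (x ^ n) = n * w.d1 x := by
  induction n with
  | zero => simp [one1]
  | succ n ih => rw [pow_succ, w.mul1 _ _ (pow_ne_zero _ hx) hx, ih]; push_cast; ring

lemma pow2 (x : E) (hx : x ≠ 0) (n : ℕ) : w.d2 (x ^ n) = n * w.d2 x := by
  induction n with
  | zero => simp [one2]
  | succ n ih => rw [pow_succ, w.mul2 _ _ (pow_ne_zero _ hx) hx, ih]; push_cast; ring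

lemma sum {ι : Type} (T : Finset ι) (hT : T.Nonempty) (f : ι → E) (h0 : ∀ i ∈ T, f i ≠ 0)
    (hd : ∀ i ∈ T, ∀ j ∈ T, w.d1 (f i) = w.d1 (f j) → w.d2 (f i) = w.d2 (f j) → i = j) :
    ∃ i ∈ T, (∑ j ∈ T, f j) ≠ 0 ∧ w.d1 (∑ j ∈ T, f j) = w.d1 (f i) ∧
      w.d2 (∑ j ∈ T, f j) = w.d2 (f i) := by
  induction hT using Finset.Nonempty.cons_induction with
  | singleton a => exact ⟨a, by simp, by simpa using h0⟩
  | cons a s ha hs ih =>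
    obtain ⟨i, hi, hne, e1, e2⟩ := ih (fun i hi => h0 i (by simp [hi]))
      (fun i hi j hj => hd i (by simp [hi]) j (by simp [hj]))
    have hai : a ≠ i := fun h => ha (h ▸ hi)
    have hne2 := h0 a (by simp)
    have key : ¬ (w.d1 (f a) = w.d1 (f i) ∧ w.d2 (f a) = w.d2 (f i)) := fun h =>
      hai (hd a (by simp) i (by simp [hi]) h.1 h.2)
    rw [Finset.sum_cons]
    by_cases hlt : w.d1 (f a) < w.d1 (f i) ∨ (w.d1 (f a) = w.d1 (f i) ∧ w.d2 (f a) < w.d2 (f i))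
    · exact ⟨a, by simp, w.add _ _ hne2 hne (by rw [e1, e2]; exact hlt)⟩
    · have := w.add _ _ hne hne2 (by rw [e1, e2]; omega)
      rw [add_comm] at this
      exact ⟨i, by simp [hi], this.1, by rw [this.2.1, e1], by rw [this.2.2, e2]⟩

lemma eval {R : Type} [Field R] (j : R →+* E) (y : E) (hy : y ≠ 0)
    (hd : ∀ a b : R, a ≠ 0 → b ≠ 0 → ∀ m n : ℕ,
      w.d1 (j a) + m * w.d1 y = w.d1 (j b) + n * w.d1 y →
      w.d2 (j a) + m * w.d2 y = w.d2 (j b) + n * w.d2 y → m = n)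
    (p : Polynomial R) (hp : p ≠ 0) :
    ∃ (a : R) (m : ℕ), a ≠ 0 ∧ p.eval₂ j y ≠ 0 ∧
      w.d1 (p.eval₂ j y) = w.d1 (j a) + m * w.d1 y ∧
      w.d2 (p.eval₂ j y) = w.d2 (j a) + m * w.d2 y := by
  rw [Polynomial.eval₂_eq_sum, Polynomial.sum]
  have hc : ∀ i ∈ p.support, p.coeff i ≠ 0 := fun i hi => Polynomial.mem_support_iff.1 hi
  have hj : ∀ i ∈ p.support, j (p.coeff i) ≠ 0 := fun i hi => by simpa using hc i hi
  have v1 : ∀ i ∈ p.support, w.d1 (j (p.coeff i) * y ^ i) = w.d1 (j (p.coeff i)) + i * w.d1 y :=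
    fun i hi => by rw [w.mul1 _ _ (hj i hi) (pow_ne_zero _ hy), pow1 _ _ hy]
  have v2 : ∀ i ∈ p.support, w.d2 (j (p.coeff i) * y ^ i) = w.d2 (j (p.coeff i)) + i * w.d2 y :=
    fun i hi => by rw [w.mul2 _ _ (hj i hi) (pow_ne_zero _ hy), pow2 _ _ hy]
  obtain ⟨i, hi, h0, h1, h2⟩ := w.sum p.support (Polynomial.support_nonempty.2 hp)
    (fun i => j (p.coeff i) * y ^ i) (fun i hi => mul_ne_zero (hj i hi) (pow_ne_zero _ hy))
    (fun a ha b hb e1 e2 => by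
      rw [v1 a ha, v1 b hb] at e1
      rw [v2 a ha, v2 b hb] at e2
      exact hd _ _ (hc a ha) (hc b hb) a b e1 e2)
  exact ⟨p.coeff i, i, hc i hi, h0, by rw [h1, v1 i hi], by rw [h2, v2 i hi]⟩

/-- Extension of a homomorphism to the rational function field, with control of values. -/
lemma exists_lift {R : Type} [Field R] (j : R →+* E) (y : E) (hy : y ≠ 0)
    (hd : ∀ a b : R, a ≠ 0 → b ≠ 0 → ∀ m n : ℕ,
      w.d1 (j a) + m * w.d1 y = w.d1 (j b) + n * w.d1 y →
      w.d2 (j a) + m * w.d2 y = w.d2 (j b) + n * w.d2 y → m = n) :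
    ∃ J : RatFunc R →+* E, J RatFunc.X = y ∧ (∀ a, J (RatFunc.C a) = j a) ∧
      ∀ g : RatFunc R, g ≠ 0 → ∃ (a b : R) (m n : ℕ), a ≠ 0 ∧ b ≠ 0 ∧
        w.d1 (J g) = w.d1 (j a) + m * w.d1 y - (w.d1 (j b) + n * w.d1 y) ∧
        w.d2 (J g) = w.d2 (j a) + m * w.d2 y - (w.d2 (j b) + n * w.d2 y) := by
  have hev := w.eval j y hy hd
  have hinj : Function.Injective (Polynomial.eval₂RingHom j y) := by
    rw [injective_iff_map_eq_zero]
    intro p hp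
    by_contra h
    obtain ⟨_, _, _, h0, _⟩ := hev p h
    exact h0 hp
  refine ⟨RatFunc.liftRingHom (Polynomial.eval₂RingHom j y)
    (nonZeroDivisors_le_comap_nonZeroDivisors_of_injective _ hinj), ?_, ?_, ?_⟩
  · rw [← RatFunc.algebraMap_X, RatFunc.liftRingHom_algebraMap]; simp
  · intro a
    rw [← RatFunc.algebraMap_C, RatFunc.liftRingHom_algebraMap]; simp
  · intro g hg
    rw [RatFunc.liftRingHom_apply]
    obtain ⟨a, m, ha, n0, a1, a2⟩ := hev g.num (RatFunc.num_ne_zero hg)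
    obtain ⟨b, n, hb, m0, b1, b2⟩ := hev g.denom (RatFunc.denom_ne_zero g)
    refine ⟨a, b, m, n, ha, hb, ?_, ?_⟩
    · rw [Polynomial.coe_eval₂RingHom, div_eq_mul_inv, w.mul1 _ _ n0 (inv_ne_zero m0),
        w.inv1 _ m0, a1, b1]; ring
    · rw [Polynomial.coe_eval₂RingHom, div_eq_mul_inv, w.mul2 _ _ n0 (inv_ne_zero m0),
        w.inv2 _ m0, a2, b2]; ring

end
end Val2

/-- The valuation on Hahn series with exponents in `ℤ ×ₗ ℤ`. -/
noncomputable def hahnVal (k : Type) [Field k] : Val2 (HahnSeries (ℤ ×ₗ ℤ) k) where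
  d1 x := (ofLex x.order).1
  d2 x := (ofLex x.order).2
  mul1 x y hx hy := by rw [HahnSeries.order_mul hx hy]; rfl
  mul2 x y hx hy := by rw [HahnSeries.order_mul hx hy]; rfl
  add x y hx hy h := by
    have hlt : x.order < y.order := Prod.Lex.lt_iff.2 h
    have hlt' : x.orderTop < y.orderTop := by
      rw [← HahnSeries.order_eq_orderTop_of_ne_zero hx,
        ← HahnSeries.order_eq_orderTop_of_ne_zero hy]
      exact_mod_cast hlt
    have e := HahnSeries.orderTop_add_eq_left hlt'
    have hne : x + y ≠ 0 := by
      intro h0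
      rw [h0, HahnSeries.orderTop_zero] at e
      rw [← e] at hlt'
      exact not_top_lt hlt'
    rw [← HahnSeries.order_eq_orderTop_of_ne_zero hx,
        ← HahnSeries.order_eq_orderTop_of_ne_zero hne] at e
    have e' : (x + y).order = x.order := by exact_mod_cast e
    exact ⟨hne, by rw [e'], by rw [e']⟩

/-- The embedding of `k(x,y)` into Hahn series. -/
lemma exists_embed (k : Type) [Field k] :
    ∃ (J : RatFunc2 k →+* HahnSeries (ℤ ×ₗ ℤ) k) (u V : HahnSeries (ℤ ×ₗ ℤ) k),
      J (xV k) = u ^ 2 + u ∧ J (xV k ^ (-2 : ℤ) * (yV k)⁻¹) = V ^ 2 + V ∧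
      (hahnVal k).d1 (J (xV k)) = -2 ∧ (hahnVal k).d2 (J (xV k)) = -2 ∧
      (hahnVal k).d1 (J (xV k ^ (-2 : ℤ) * (yV k)⁻¹)) = -2 ∧
      (hahnVal k).d2 (J (xV k ^ (-2 : ℤ) * (yV k)⁻¹)) = 0 ∧
      ∀ g, g ≠ 0 → Even ((hahnVal k).d1 (J g)) ∧ Even ((hahnVal k).d2 (J g)) := by
  set w := hahnVal k with hw
  let u : HahnSeries (ℤ ×ₗ ℤ) k := HahnSeries.single (toLex (-1, -1)) 1
  let V : HahnSeries (ℤ ×ₗ ℤ) k := HahnSeries.single (toLex (-1, 0)) 1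
  have u0 : u ≠ 0 := by simp [u]
  have V0 : V ≠ 0 := by simp [V]
  have u1 : w.d1 u = -1 := by
    change (ofLex u.order).1 = -1
    rw [HahnSeries.order_single one_ne_zero]; rfl
  have u2 : w.d2 u = -1 := by
    change (ofLex u.order).2 = -1
    rw [HahnSeries.order_single one_ne_zero]; rfl
  have V1 : w.d1 V = -1 := by
    change (ofLex V.order).1 = -1
    rw [HahnSeries.order_single one_ne_zero]; rfl
  have V2 : w.d2 V = 0 := by
    change (ofLex V.order).2 = 0
    rw [HahnSeries.order_single one_ne_zero]; rfl
  obtain ⟨x0, x1, x2⟩ := w.add (u ^ 2) u (pow_ne_zero _ u0) u0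
    (by rw [w.pow1 _ u0, w.pow2 _ u0, u1, u2]; norm_num)
  obtain ⟨s0, s1, s2⟩ := w.add (V ^ 2) V (pow_ne_zero _ V0) V0
    (by rw [w.pow1 _ V0, w.pow2 _ V0, V1, V2]; norm_num)
  rw [w.pow1 _ u0, u1] at x1
  rw [w.pow2 _ u0, u2] at x2
  rw [w.pow1 _ V0, V1] at s1
  rw [w.pow2 _ V0, V2] at s2
  norm_num at x1 x2 s1 s2
  set x := u ^ 2 + u with hx
  set s := V ^ 2 + V with hs
  have hC1 : ∀ a : k, w.d1 (HahnSeries.C a) = 0 := fun a => by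
    change (ofLex (HahnSeries.C a : HahnSeries (ℤ ×ₗ ℤ) k).order).1 = 0
    rw [HahnSeries.order_C]; rfl
  have hC2 : ∀ a : k, w.d2 (HahnSeries.C a) = 0 := fun a => by
    change (ofLex (HahnSeries.C a : HahnSeries (ℤ ×ₗ ℤ) k).order).2 = 0
    rw [HahnSeries.order_C]; rfl
  obtain ⟨j, jX, jC, jv⟩ := w.exists_lift (HahnSeries.C) x x0 (by
    intro a b _ _ m n
    rw [hC1, hC1, x1]; intro h _; omega)
  have jv' : ∀ g, g ≠ 0 → ∃ n : ℤ, w.d1 (j g) = 2 * n ∧ w.d2 (j g) = 2 * n := by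
    intro g hg
    obtain ⟨a, b, m, n, _, _, h1, h2⟩ := jv g hg
    rw [hC1, hC1, x1] at h1
    rw [hC2, hC2, x2] at h2
    exact ⟨n - m, by omega, by omega⟩
  have hxs : x ^ 2 * s ≠ 0 := mul_ne_zero (pow_ne_zero _ x0) s0
  have y1 : w.d1 (x ^ 2 * s)⁻¹ = 6 := by
    rw [w.inv1 _ hxs, w.mul1 _ _ (pow_ne_zero _ x0) s0, w.pow1 _ x0, x1, s1]; norm_num
  have y2 : w.d2 (x ^ 2 * s)⁻¹ = 4 := by
    rw [w.inv2 _ hxs, w.mul2 _ _ (pow_ne_zero _ x0) s0, w.pow2 _ x0, x2, s2]; norm_num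
  obtain ⟨J, JX, JC, Jv⟩ := w.exists_lift j (x ^ 2 * s)⁻¹ (inv_ne_zero hxs) (by
    intro a b ha hb m n
    obtain ⟨p, p1, p2⟩ := jv' a ha
    obtain ⟨q, q1, q2⟩ := jv' b hb
    rw [y1, y2, p1, p2, q1, q2]; intro h1 h2; omega)
  have Jx : J (xV k) = x := by rw [xV, JC, jX]
  have Js : J (xV k ^ (-2 : ℤ) * (yV k)⁻¹) = s := by
    rw [map_mul, map_inv₀, map_zpow₀, Jx, yV, JX, inv_inv, zpow_neg, ← mul_assoc]
    rw [show (2 : ℤ) = ((2 : ℕ) : ℤ) from rfl, zpow_natCast, inv_mul_cancel₀ (pow_ne_zero _ x0),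
      one_mul]
  refine ⟨J, u, V, Jx, Js, by rw [Jx, x1], by rw [Jx, x2], by rw [Js, s1], by rw [Js, s2], ?_⟩
  intro g hg
  obtain ⟨a, b, m, n, ha, hb, h1, h2⟩ := Jv g hg
  obtain ⟨p, p1, p2⟩ := jv' a ha
  obtain ⟨q, q1, q2⟩ := jv' b hb
  rw [y1, p1, q1] at h1
  rw [y2, p2, q2] at h2
  exact ⟨⟨p + m * 3 - q - n * 3, by rw [h1]; ring⟩, ⟨p + m * 2 - q - n * 2, by rw [h2]; ring⟩⟩

/-! ### The quaternary form -/

namespace Val2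
variable {E : Type} [Field E] (w : Val2 E)

lemma as_val [CharP E 2] (q r : E) (h : q ^ 2 + q = r) (hr : r ≠ 0) (h1 : w.d1 r = -2) :
    q ≠ 0 ∧ 2 * w.d1 q = w.d1 r ∧ 2 * w.d2 q = w.d2 r := by
  have q0 : q ≠ 0 := by rintro rfl; apply hr; rw [← h]; ring
  have hq : r + q ^ 2 = q := by
    have := CharTwo.add_self_eq_zero (q ^ 2)
    linear_combination this - h
  have e1 := w.pow1 q q0 2
  have e2 := w.pow2 q q0 2
  push_cast at e1 e2
  refine ⟨q0, ?_⟩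
  by_cases hlt : w.d1 q < 0
  · obtain ⟨_, a1, a2⟩ := w.add (q ^ 2) q (pow_ne_zero _ q0) q0 (by omega)
    rw [h] at a1 a2
    omega
  · obtain ⟨_, a1, a2⟩ := w.add r (q ^ 2) hr (pow_ne_zero _ q0) (by omega)
    rw [hq] at a1
    omega

lemma G_val (α β γ m n : E) (α0 : α ≠ 0) (β0 : β ≠ 0) (γ0 : γ ≠ 0)
    (α1 : w.d1 α = -3) (α2 : w.d2 α = -1) (β1 : w.d1 β = -3) (β2 : w.d2 β = 0)
    (γ1 : w.d1 γ = -3) (γ2 : w.d2 γ = 0) (hmn : ¬ (m = 0 ∧ n = 0)) :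
    α * m ^ 2 + β * (m * n) + γ * n ^ 2 ≠ 0 ∧
      Odd (w.d1 (α * m ^ 2 + β * (m * n) + γ * n ^ 2)) := by
  have A1 : ∀ m : E, m ≠ 0 → w.d1 (α * m ^ 2) = -3 + 2 * w.d1 m := fun m hm => by
    rw [w.mul1 _ _ α0 (pow_ne_zero _ hm), w.pow1 _ hm, α1]; rfl
  have A2 : ∀ m : E, m ≠ 0 → w.d2 (α * m ^ 2) = -1 + 2 * w.d2 m := fun m hm => by
    rw [w.mul2 _ _ α0 (pow_ne_zero _ hm), w.pow2 _ hm, α2]; rfl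
  have C1 : ∀ m : E, m ≠ 0 → w.d1 (γ * m ^ 2) = -3 + 2 * w.d1 m := fun m hm => by
    rw [w.mul1 _ _ γ0 (pow_ne_zero _ hm), w.pow1 _ hm, γ1]; rfl
  have C2 : ∀ m : E, m ≠ 0 → w.d2 (γ * m ^ 2) = 2 * w.d2 m := fun m hm => by
    rw [w.mul2 _ _ γ0 (pow_ne_zero _ hm), w.pow2 _ hm, γ2]; simp
  by_cases hm : m = 0
  · have hn : n ≠ 0 := fun h => hmn ⟨hm, h⟩
    subst hm
    have e : α * 0 ^ 2 + β * (0 * n) + γ * n ^ 2 = γ * n ^ 2 := by ring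
    rw [e]
    exact ⟨mul_ne_zero γ0 (pow_ne_zero _ hn), ⟨w.d1 n - 2, by rw [C1 n hn]; ring⟩⟩
  by_cases hn : n = 0
  · subst hn
    have e : α * m ^ 2 + β * (m * 0) + γ * 0 ^ 2 = α * m ^ 2 := by ring
    rw [e]
    exact ⟨mul_ne_zero α0 (pow_ne_zero _ hm), ⟨w.d1 m - 2, by rw [A1 m hm]; ring⟩⟩
  have B1 : w.d1 (β * (m * n)) = -3 + (w.d1 m + w.d1 n) := by
    rw [w.mul1 _ _ β0 (mul_ne_zero hm hn), w.mul1 _ _ hm hn, β1]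
  have B2 : w.d2 (β * (m * n)) = w.d2 m + w.d2 n := by
    rw [w.mul2 _ _ β0 (mul_ne_zero hm hn), w.mul2 _ _ hm hn, β2]; ring
  have tA := mul_ne_zero α0 (pow_ne_zero 2 hm)
  have tB := mul_ne_zero β0 (mul_ne_zero hm hn)
  have tC := mul_ne_zero γ0 (pow_ne_zero 2 hn)
  have a1 := A1 m hm
  have a2 := A2 m hm
  have c1 := C1 n hn
  have c2 := C2 n hn
  by_cases hlt : w.d1 m < w.d1 n ∨ (w.d1 m = w.d1 n ∧ w.d2 m ≤ w.d2 n)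
  · obtain ⟨t0, t1, t2⟩ := w.add _ _ tA tB (by omega)
    obtain ⟨r0, r1, r2⟩ := w.add _ _ t0 tC (by omega)
    exact ⟨r0, ⟨w.d1 m - 2, by omega⟩⟩
  · obtain ⟨t0, t1, t2⟩ := w.add _ _ tC tB (by omega)
    obtain ⟨r0, r1, r2⟩ := w.add _ _ t0 tA (by omega)
    have e : α * m ^ 2 + β * (m * n) + γ * n ^ 2 = γ * n ^ 2 + β * (m * n) + α * m ^ 2 := by ring
    rw [e]
    exact ⟨r0, ⟨w.d1 n - 2, by omega⟩⟩

end Val2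

section quaternary
variable {E : Type} [Field E]

/-- The quaternary quadratic form. -/
def qq (o x s c : E) (X : Fin 4 → E) : E :=
  X 0 ^ 2 + X 0 * X 1 + (o * x + c) * X 1 ^ 2 + o * s * X 2 ^ 2 + (o ^ 2 * s + 1) * X 2 * X 3
    + o * x * s * X 3 ^ 2 + c * X 1 * X 3

/-- Its polar form (in characteristic two). -/
def bb (s c o : E) (W X : Fin 4 → E) : E :=
  W 1 * X 0 + (W 0 + c * W 3) * X 1 + (o ^ 2 * s + 1) * W 3 * X 2
    + ((o ^ 2 * s + 1) * W 2 + c * W 1) * X 3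

lemma qq_add [CharP E 2] (o x s c : E) (W X : Fin 4 → E) :
    qq o x s c (W + X) = qq o x s c W + qq o x s c X + bb s c o W X := by
  have h2 : (2 : E) = 0 := CharTwo.two_eq_zero
  simp only [qq, bb, Pi.add_apply]
  linear_combination (W 0 * X 0 + (o * x + c) * W 1 * X 1 + o * s * W 2 * X 2
    + o * x * s * W 3 * X 3) * h2

lemma qq_smul (o x s c t : E) (X : Fin 4 → E) :
    qq o x s c (t • X) = t ^ 2 * qq o x s c X := by
  simp only [qq, Pi.smul_apply, smul_eq_mul]
  ring

/-- The isotropic vector. -/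
def zz (o u V : E) : Fin 4 → E := ![u + o ^ 2 * u * V, V, u, 1]

lemma qq_perp [CharP E 2] (o x s c u V : E) (ho : o ^ 2 + o + 1 = 0) (hu : u ^ 2 + u = x)
    (hV : V ^ 2 + V = s) (hc : c * s = x) (V0 : V ≠ 0) (X : Fin 4 → E)
    (hX : bb s c o (zz o u V) X = 0) :
    ∃ m n : E, qq o x s c X =
        (c ^ 2 + u * (1 + s)) * m ^ 2 + (V * (o ^ 2 * s + 1)) * (m * n) + (1 + o * s * V) * n ^ 2 ∧
      (m = 0 → n = 0 → X = X 3 • zz o u V) := by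
  have h2 : (2 : E) = 0 := CharTwo.two_eq_zero
  set r := X 3 with hr
  obtain ⟨m, hm⟩ : ∃ m, X 1 = V * m + r * V := ⟨(X 1 - r * V) / V, by field_simp; ring⟩
  obtain ⟨n, hn⟩ : ∃ n, X 2 = V * n + r * u := ⟨(X 2 - r * u) / V, by field_simp; ring⟩
  have h0 : X 0 = (u + o ^ 2 * u * V + c) * m + (o ^ 2 * s + 1) * n
      + r * (u + o ^ 2 * u * V) := by
    apply mul_left_cancel₀ V0
    simp only [bb, zz, Matrix.cons_val_zero, Matrix.cons_val_one, Matrix.cons_val] at hX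
    rw [hm, hn, ← hr] at hX
    linear_combination hX - ((u + o ^ 2 * u * V + c) * V * m + (o ^ 2 * s + 1) * V * n
      + (u + o ^ 2 * u * V + c) * V * r + (o ^ 2 * s + 1) * u * r) * h2
  refine ⟨m, n, ?_, ?_⟩
  · simp only [qq]
    rw [h0, hm, hn, ← hr]
    subst hu hV
    grind
  · intro m0 n0
    subst m0 n0
    funext i
    fin_cases i
    · simp [zz, h0]
    · simp [zz, hm]
    · simp [zz, hn]
    · simp [zz, hr]

end quaternary

section key
variable {E : Type} [Field E] [CharP E 2]

lemma bb_comm (s c o : E) (W X : Fin 4 → E) : bb s c o W X = bb s c o X W := by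
  have h2 : (2 : E) = 0 := CharTwo.two_eq_zero
  simp only [bb]
  ring

lemma bb_add_right (s c o : E) (W X Y : Fin 4 → E) :
    bb s c o W (X + Y) = bb s c o W X + bb s c o W Y := by
  simp only [bb, Pi.add_apply]; ring

lemma bb_smul_right (s c o t : E) (W X : Fin 4 → E) :
    bb s c o W (t • X) = t * bb s c o W X := by
  simp only [bb, Pi.smul_apply, smul_eq_mul]; ring

lemma qq_zz (o x s c u V : E) (ho : o ^ 2 + o + 1 = 0) (hu : u ^ 2 + u = x)
    (hV : V ^ 2 + V = s) (hc : c * s = x) : qq o x s c (zz o u V) = 0 := by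
  have h2 : (2 : E) = 0 := CharTwo.two_eq_zero
  simp only [qq, zz, Matrix.cons_val_zero, Matrix.cons_val_one, Matrix.cons_val]
  subst hu hV
  grind

/-- All the data entering the argument. -/
structure Setup (w : Val2 E) (o x s c u V : E) : Prop where
  ho : o ^ 2 + o + 1 = 0
  hu : u ^ 2 + u = x
  hV : V ^ 2 + V = s
  hc : c * s = x
  x0 : x ≠ 0
  s0 : s ≠ 0
  x1 : w.d1 x = -2
  x2 : w.d2 x = -2
  s1 : w.d1 s = -2
  s2 : w.d2 s = 0

lemma Setup.perp {w : Val2 E} {o x s c u V : E} (S : Setup w o x s c u V) (X : Fin 4 → E)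
    (hX : bb s c o (zz o u V) X = 0) :
    (qq o x s c X ≠ 0 → Odd (w.d1 (qq o x s c X))) ∧
      (qq o x s c X = 0 → X = X 3 • zz o u V) := by
  obtain ⟨ho, hu, hV, hc, x0, s0, x1, x2, s1, s2⟩ := S
  have h2 : (2 : E) = 0 := CharTwo.two_eq_zero
  obtain ⟨u0, u1, u2⟩ := w.as_val u x hu x0 x1
  obtain ⟨V0, V1, V2⟩ := w.as_val V s hV s0 s1
  have c0 : c ≠ 0 := by rintro rfl; apply x0; rw [← hc]; ring
  have c1 := w.mul1 c s c0 s0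
  have c2 := w.mul2 c s c0 s0
  rw [hc] at c1 c2
  have o0 : o ≠ 0 := by rintro rfl; norm_num at ho
  have o3 : o ^ 3 = 1 := by linear_combination (o - 1) * ho
  have o1 := w.pow1 o o0 3
  have o2 := w.pow2 o o0 3
  rw [o3, w.one1] at o1
  rw [o3, w.one2] at o2
  push_cast at o1 o2
  -- coefficient of the square of m
  obtain ⟨a0, a1, a2⟩ := w.add s 1 s0 one_ne_zero (by rw [w.one1]; omega)
  have b1 := w.mul1 u (s + 1) u0 a0
  have b2 := w.mul2 u (s + 1) u0 a0
  have b0 := mul_ne_zero u0 a0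
  have cc1 := w.pow1 c c0 2
  push_cast at cc1
  obtain ⟨α0, α1, α2⟩ := w.add (u * (s + 1)) (c ^ 2) b0 (pow_ne_zero _ c0) (by omega)
  rw [show u * (s + 1) + c ^ 2 = c ^ 2 + u * (1 + s) by ring] at α0 α1 α2
  -- mixed coefficient
  have oo0 := pow_ne_zero 2 o0
  have oo1 := w.pow1 o o0 2
  have oo2 := w.pow2 o o0 2
  push_cast at oo1 oo2
  have l0 := mul_ne_zero oo0 s0
  have l1 := w.mul1 _ _ oo0 s0
  have l2 := w.mul2 _ _ oo0 s0
  obtain ⟨m0, m1, m2⟩ := w.add (o ^ 2 * s) 1 l0 one_ne_zero (by rw [w.one1]; omega)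
  have β0 := mul_ne_zero V0 m0
  have β1 := w.mul1 _ _ V0 m0
  have β2 := w.mul2 _ _ V0 m0
  -- last coefficient
  have p0 := mul_ne_zero o0 s0
  have p1 := w.mul1 _ _ o0 s0
  have p2 := w.mul2 _ _ o0 s0
  have r0 := mul_ne_zero p0 V0
  have r1 := w.mul1 _ _ p0 V0
  have r2 := w.mul2 _ _ p0 V0
  obtain ⟨γ0, γ1, γ2⟩ := w.add (o * s * V) 1 r0 one_ne_zero (by rw [w.one1]; omega)
  rw [add_comm] at γ0 γ1 γ2
  obtain ⟨m, n, hq, hz⟩ := qq_perp o x s c u V ho hu hV hc V0 X hX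
  by_cases hmn : m = 0 ∧ n = 0
  · have hXz := hz hmn.1 hmn.2
    have : qq o x s c X = 0 := by rw [hq, hmn.1, hmn.2]; ring
    exact ⟨fun h => absurd this h, fun _ => hXz⟩
  · have := w.G_val _ _ _ m n α0 β0 γ0 (by omega) (by omega) (by omega) (by omega) (by omega)
      (by omega) hmn
    rw [← hq] at this
    exact ⟨fun _ => this.2, fun h => absurd h this.1⟩

lemma Setup.key {w : Val2 E} {o x s c u V : E} (S : Setup w o x s c u V) (Y W : Fin 4 → E)
    (hY : Y ≠ 0) (hqY : qq o x s c Y = 0) (hb : bb s c o Y W = 0) (hW : qq o x s c W ≠ 0) :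
    Odd (w.d1 (qq o x s c W)) := by
  by_cases hC : bb s c o (zz o u V) Y = 0
  · have hYz := (S.perp Y hC).2 hqY
    have t0 : Y 3 ≠ 0 := by
      intro h; rw [h, zero_smul] at hYz; exact hY hYz
    have : bb s c o (zz o u V) W = 0 := by
      rw [hYz, bb_comm, bb_smul_right, bb_comm] at hb
      exact (mul_eq_zero.1 hb).resolve_left t0
    exact (S.perp W this).1 hW
  · set t := - bb s c o (zz o u V) W / bb s c o (zz o u V) Y with ht
    have h1 : bb s c o (zz o u V) (W + t • Y) = 0 := by
      rw [bb_add_right, bb_smul_right, ht, div_mul_cancel₀ _ hC]; ring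
    have h3 : qq o x s c (W + t • Y) = qq o x s c W := by
      rw [qq_add, qq_smul, hqY, bb_smul_right, bb_comm, hb]; ring
    have := (S.perp _ h1).1 (by rw [h3]; exact hW)
    rwa [h3] at this

end key

/-! ### Unfolding Witt decompositions -/

namespace QF
section unfold
variable {E : Type} [Field E]

lemma form_apply (q : QF E) (X : Fin q.n → E) :
    q.form X = ∑ i, ∑ j, X i * q.M i j * X j := by
  unfold form
  change Matrix.toLinearMap₂' E q.M X X = _
  rw [Matrix.toLinearMap₂'_apply']
  simp [dotProduct, Matrix.mulVec, Finset.mul_sum, mul_assoc]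

lemma oplus_form (p q : QF E) (X : Fin p.n → E) (Y : Fin q.n → E) :
    (oplus p q).form (Fin.append X Y : Fin (p.n + q.n) → E) = p.form X + q.form Y := by
  rw [form_apply p, form_apply q]
  refine (form_apply (oplus p q) (Fin.append X Y : Fin (p.n + q.n) → E)).trans ?_
  change (∑ i : Fin (p.n + q.n), ∑ j : Fin (p.n + q.n), _) = _
  simp only [Fin.sum_univ_add, Fin.append_left, Fin.append_right]
  simp [oplus]

lemma hypN_n (i : ℕ) : (hypN i : QF E).n = 2 * i := by
  induction i with
  | zero => rfl
  | succ i ih =>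
    change 2 + (hypN i : QF E).n = _
    rw [ih]; ring

lemma hypN_succ (i : ℕ) : (hypN (i + 1) : QF E) = oplus (bin 0 0) (hypN i) := rfl

lemma bin_form (a b x y : E) :
    (bin a b).form (![x, y] : Fin 2 → E) = a * x ^ 2 + x * y + b * y ^ 2 := by
  refine (form_apply (bin a b) ![x, y]).trans ?_
  change (∑ i : Fin 2, ∑ j : Fin 2, _) = _
  simp [Fin.sum_univ_two, bin]
  ring

lemma zeroN_form (j : ℕ) (X : Fin j → E) : (zeroN j : QF E).form X = 0 := by
  refine (form_apply (zeroN j) X).trans ?_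
  simp [zeroN]

lemma append_add {m n : ℕ} (X X' : Fin m → E) (Y Y' : Fin n → E) :
    Fin.append X Y + Fin.append X' Y' = Fin.append (X + X') (Y + Y') := by
  funext i
  refine Fin.addCases (fun i => ?_) (fun i => ?_) i <;> simp

lemma append_ne {m n : ℕ} (X : Fin m → E) (Y : Fin n → E) (h : X ≠ 0 ∨ Y ≠ 0) :
    Fin.append X Y ≠ 0 := by
  intro h0
  have h1 : X = 0 := by
    funext i
    have := congrFun h0 (Fin.castAdd n i)
    simpa using this
  have h2 : Y = 0 := by
    funext i
    have := congrFun h0 (Fin.natAdd m i)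
    simpa using this
  tauto

lemma append_surj {m n : ℕ} (X : Fin (m + n) → E) :
    ∃ (Y : Fin m → E) (Z : Fin n → E), X = Fin.append Y Z :=
  ⟨_, _, (Fin.append_castAdd_natAdd (f := X)).symm⟩

lemma bc_form {F : Type} [Field F] [Algebra F E] (q : QF F) (X : Fin q.n → F) :
    (q.bc E).form (fun i => algebraMap F E (X i) : Fin q.n → E) = algebraMap F E (q.form X) := by
  rw [form_apply q]
  refine (form_apply (q.bc E) (fun i => algebraMap F E (X i))).trans ?_
  change (∑ i : Fin q.n, ∑ j : Fin q.n, _) = _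
  simp [bc, QF.map]

set_option maxHeartbeats 1000000 in
lemma not_anisoPart {F : Type} [Field F] [Algebra F E] (q : QF E) (ψ : QF F) (hn : q.n = 4)
    (hnd : ∀ R, (∀ A, q.form (A + R) = q.form A) → R = 0)
    (hiso : ∃ z, z ≠ 0 ∧ q.form z = 0)
    (hkey : ∀ Y W g, Y ≠ 0 → q.form Y = 0 → q.form (Y + W) = q.form Y + q.form W →
      q.form W = algebraMap F E g → g ≠ 0 → False) :
    ¬ IsAnisoPartOf q (ψ.bc E) := by
  rintro ⟨han, i, j, ⟨e⟩⟩
  -- transport of the properties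
  set T := oplus (ψ.bc E) (oplus (hypN i) (zeroN j)) with hT
  have hd : T.n = 4 := by
    have := e.toLinearEquiv.finrank_eq
    simp only [Module.finrank_fintype_fun_eq_card, Fintype.card_fin] at this
    omega
  have hTn : T.n = ψ.n + ((hypN i : QF E).n + j) := rfl
  rw [hypN_n] at hTn
  have hf : ∀ X, q.form (e.symm X) = T.form X := fun X => e.symm.map_app X
  have hnd' : ∀ R, (∀ A, T.form (A + R) = T.form A) → R = 0 := by
    intro R hR
    have h1 : e.symm R = 0 := by
      apply hnd
      intro A
      have := hR (e A)
      rw [← hf, ← hf] at this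
      have e1 : e.symm (e A + R) = A + e.symm R := by
        change e.toLinearEquiv.symm (e.toLinearEquiv A + R) = _
        rw [map_add, LinearEquiv.symm_apply_apply]; rfl
      have e2 : e.symm (e A) = A := e.toLinearEquiv.symm_apply_apply A
      rwa [e1, e2] at this
    exact e.toLinearEquiv.symm.map_eq_zero_iff.1 h1
  have hkey' : ∀ Y W g, Y ≠ 0 → T.form Y = 0 → T.form (Y + W) = T.form Y + T.form W →
      T.form W = algebraMap F E g → g ≠ 0 → False := by
    intro Y W g hY hqY hadd hW hg
    refine hkey (e.symm Y) (e.symm W) g ?_ ?_ ?_ ?_ hg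
    · intro h
      exact hY (e.toLinearEquiv.symm.map_eq_zero_iff.1 h)
    · rw [hf, hqY]
    · rw [hf, hf, ← hadd, ← hf]
      congr 1
      exact (e.toLinearEquiv.symm.map_add Y W).symm
    · rw [hf, hW]
  have hTf : ∀ (A : Fin ψ.n → E) (B : Fin (hypN i : QF E).n → E) (C : Fin j → E),
      T.form (Fin.append A (Fin.append B C) : Fin (ψ.n + ((hypN i : QF E).n + j)) → E)
        = (ψ.bc E).form A + ((hypN i : QF E).form B) := by
    intro A B C
    have h1 := oplus_form (ψ.bc E) (oplus (hypN i) (zeroN j)) A (Fin.append B C)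
    have h2 := oplus_form (hypN i : QF E) (zeroN j) B C
    rw [zeroN_form, add_zero] at h2
    rw [h2] at h1
    exact h1
  have hψ0 : (ψ.bc E).form (0 : Fin ψ.n → E) = 0 := map_zero (ψ.bc E).form
  have hψ1 : (ψ.bc E).form (0 + 0 : Fin ψ.n → E) = 0 := by rw [add_zero]; exact hψ0
  have hψ2 : ∀ A : Fin ψ.n → E, (ψ.bc E).form (0 + A : Fin ψ.n → E) = (ψ.bc E).form A :=
    fun A => by rw [zero_add]
  have hh0 : ∀ i, (hypN i : QF E).form (0 : Fin (hypN i : QF E).n → E) = 0 := fun i => map_zero _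
  -- no radical
  rcases Nat.eq_zero_or_pos j with hj | hj
  swap
  · have : (Fin.append (0 : Fin ψ.n → E) (Fin.append (0 : Fin (hypN i : QF E).n → E)
        (fun _ : Fin j => (1 : E)))) = 0 := by
      apply hnd'
      intro A
      obtain ⟨A1, A', rfl⟩ := append_surj (m := ψ.n) (n := (hypN i : QF E).n + j) A
      obtain ⟨A2, A3, rfl⟩ := append_surj (m := (hypN i : QF E).n) (n := j) A'
      have := append_add A1 0 (Fin.append A2 A3) (Fin.append (0 : Fin (hypN i : QF E).n → E)
        (fun _ : Fin j => (1 : E)))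
      rw [append_add A2 0 A3] at this
      refine (congrArg T.form this).trans ?_
      refine (hTf _ _ _).trans (Eq.trans ?_ (hTf _ _ _).symm)
      rw [add_zero, add_zero]
    refine append_ne _ _ (Or.inr (append_ne _ _ (Or.inr ?_))) this
    intro h
    exact one_ne_zero (congrFun h ⟨0, hj⟩)
  -- Witt index at least one
  rcases i with _ | i
  · obtain ⟨z, z0, hz⟩ := hiso
    have hez : T.form (e z) = 0 := by rw [← hz]; exact e.map_app z
    have hez0 : e z ≠ 0 := fun h => z0 (e.toLinearEquiv.map_eq_zero_iff.1 h)
    obtain ⟨A1, A', hA⟩ := append_surj (m := ψ.n) (n := (hypN 0 : QF E).n + j) (e z)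
    obtain ⟨A2, A3, rfl⟩ := append_surj (m := (hypN 0 : QF E).n) (n := j) A'
    rw [hA, hTf] at hez
    have e2 : A2 = 0 := by funext t; exact t.elim0
    have e3 : A3 = 0 := by subst hj; funext t; exact t.elim0
    rw [e2, map_zero, add_zero] at hez
    have e1 := han _ hez
    apply hez0
    rw [hA]
    have hh : A1 = 0 := e1
    rw [hh, e2, e3]
    funext t
    refine Fin.addCases (fun t => ?_) (fun t => ?_) t
    · simp; rfl
    · rw [Fin.append_right]
      refine Fin.addCases (fun t => ?_) (fun t => ?_) t
      · simp; rfl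
      · simp; rfl
  · have hH : ∀ (x y : E) (Z : Fin (hypN i : QF E).n → E),
        (hypN (i + 1) : QF E).form (Fin.append ![x, y] Z : Fin (2 + (hypN i : QF E).n) → E)
          = x * y + (hypN i : QF E).form Z := by
      intro x y Z
      have h1 := oplus_form (bin 0 0 : QF E) (hypN i) ![x, y] Z
      rw [bin_form] at h1
      refine h1.trans ?_
      ring
    let B : Fin (2 + (hypN i : QF E).n) → E := Fin.append ![1, 0] 0
    have hB : B ≠ 0 := append_ne _ _ (Or.inl (fun h => one_ne_zero (congrFun h 0)))
    have hB0 : (hypN (i + 1) : QF E).form B = 0 := by rw [hH]; simp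
    let Y : Fin (ψ.n + ((2 + (hypN i : QF E).n) + j)) → E :=
      Fin.append 0 (Fin.append B (0 : Fin j → E))
    have hY0 : Y ≠ 0 := append_ne _ _ (Or.inr (append_ne _ _ (Or.inl hB)))
    have hY : T.form Y = 0 := by
      refine (hTf 0 B 0).trans ?_
      rw [hB0, hψ0]; simp
    rcases Nat.eq_zero_or_pos ψ.n with hψ | hψ
    · rcases i with _ | i
      · omega
      · have hH2 : ∀ (x y : E), (hypN (i + 1) : QF E).form
            (Fin.append ![x, y] 0 : Fin (2 + (hypN i : QF E).n) → E) = x * y := by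
          intro x y
          have h1 := oplus_form (bin 0 0 : QF E) (hypN i) ![x, y] 0
          rw [bin_form] at h1
          refine h1.trans ?_
          simp
        let Z : Fin (hypN (i + 1) : QF E).n → E :=
          (Fin.append ![1, 1] 0 : Fin (2 + (hypN i : QF E).n) → E)
        have hZ : (hypN (i + 1) : QF E).form Z = 1 := (hH2 1 1).trans (one_mul 1)
        let D : Fin (2 + (hypN (i + 1) : QF E).n) → E := Fin.append ![0, 0] Z
        have hD : (hypN (i + 1 + 1) : QF E).form D = 1 := by
          refine (hH 0 0 Z).trans ?_
          rw [hZ]; simp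
        have hBD : (hypN (i + 1 + 1) : QF E).form (B + D) = 1 := by
          have : B + D = Fin.append (![1, 0] + ![0, 0]) (0 + Z) := append_add _ _ _ _
          rw [this]
          have h3 : (![1, 0] + ![0, 0] : Fin 2 → E) = ![1, 0] := by simp
          rw [h3, zero_add]
          refine (hH 1 0 Z).trans ?_
          rw [hZ]; simp
        let W : Fin (ψ.n + ((2 + (hypN (i + 1) : QF E).n) + j)) → E :=
          Fin.append 0 (Fin.append D (0 : Fin j → E))
        have hW : T.form W = 1 := by
          refine (hTf 0 D 0).trans ?_
          rw [hD, hψ0]; simp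
        have hYW : T.form (Y + W) = 1 := by
          have : Y + W = Fin.append (0 + 0) (Fin.append (B + D) ((0 : Fin j → E) + 0)) := by
            rw [← append_add, ← append_add]
          refine (congrArg T.form this).trans ?_
          refine (hTf _ (B + D) _).trans ?_
          rw [hBD, hψ1]; simp
        refine hkey' Y W 1 hY0 hY ?_ (by rw [hW, map_one]) one_ne_zero
        rw [hY, hW, zero_add]; exact hYW
    · let a : Fin ψ.n → F := fun _ => 1
      let A : Fin ψ.n → E := fun t => algebraMap F E (a t)
      have hA : (ψ.bc E).form A = algebraMap F E (ψ.form a) := bc_form ψ a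
      have ha : ψ.form a ≠ 0 := by
        intro h
        rw [h, map_zero] at hA
        have := congrFun (han _ hA) ⟨0, hψ⟩
        simp [A, a] at this
      let W : Fin (ψ.n + ((2 + (hypN i : QF E).n) + j)) → E :=
          Fin.append A (Fin.append (0 : Fin (2 + (hypN i : QF E).n) → E) (0 : Fin j → E))
      have hW : T.form W = algebraMap F E (ψ.form a) := by
        refine (hTf A 0 0).trans ?_
        have h3 := hh0 (i + 1)
        rw [hA]
        exact (congrArg (_ + ·) h3).trans (add_zero _)
      have hYW : T.form (Y + W) = algebraMap F E (ψ.form a) := by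
        have : Y + W = Fin.append (0 + A) (Fin.append (B + (0 : Fin (2 + (hypN i : QF E).n) → E)) ((0 : Fin j → E) + 0)) := by
          rw [← append_add, ← append_add]
        refine (congrArg T.form this).trans ?_
        refine (hTf _ (B + (0 : Fin (2 + (hypN i : QF E).n) → E)) _).trans ?_
        rw [add_zero, hB0, hψ2, hA, add_zero]
      refine hkey' Y W (ψ.form a) hY0 hY ?_ hW ha
      rw [hY, hW, zero_add]; exact hYW

end unfold
end QF

section final
variable {E : Type} [Field E]

/-- The quaternary form as a matrix-presented form. -/
def phi (o x s c : E) : QF E :=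
  ⟨4, !![1, 1, 0, 0; 0, o * x + c, 0, c; 0, 0, o * s, o ^ 2 * s + 1; 0, 0, 0, o * x * s]⟩

lemma phi_form (o x s c : E) (X : Fin 4 → E) : (phi o x s c).form X = qq o x s c X := by
  refine (QF.form_apply (phi o x s c) X).trans ?_
  change (∑ i : Fin 4, ∑ j : Fin 4, _) = _
  simp [Fin.sum_univ_four, phi, qq]
  ring

lemma phi_bc {F : Type} [Field F] [Algebra F E] (o x s c : F) :
    (phi o x s c).bc E = phi (algebraMap F E o) (algebraMap F E x) (algebraMap F E s)
      (algebraMap F E c) := by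
  unfold phi QF.bc QF.map
  congr 1
  ext i j
  fin_cases i <;> fin_cases j <;> simp

lemma Setup.lam [CharP E 2] {w : Val2 E} {o x s c u V : E} (S : Setup w o x s c u V) :
    o ^ 2 * s + 1 ≠ 0 ∧ o ≠ 0 ∧ w.d1 o = 0 := by
  obtain ⟨ho, hu, hV, hc, x0, s0, x1, x2, s1, s2⟩ := S
  have h2 : (2 : E) = 0 := CharTwo.two_eq_zero
  have o0 : o ≠ 0 := by rintro rfl; norm_num at ho
  have o3 : o ^ 3 = 1 := by linear_combination (o - 1) * ho
  have o1 := w.pow1 o o0 3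
  rw [o3, w.one1] at o1
  push_cast at o1
  have oo0 := pow_ne_zero 2 o0
  have oo1 := w.pow1 o o0 2
  push_cast at oo1
  have l0 := mul_ne_zero oo0 s0
  have l1 := w.mul1 _ _ oo0 s0
  obtain ⟨m0, m1, m2⟩ := w.add (o ^ 2 * s) 1 l0 one_ne_zero (by rw [w.one1]; omega)
  exact ⟨m0, o0, by omega⟩

lemma qq_map {F : Type} [Field F] [Algebra F E] (o x s c : F) (X : Fin 4 → F) :
    qq (algebraMap F E o) (algebraMap F E x) (algebraMap F E s) (algebraMap F E c)
      (fun i => algebraMap F E (X i)) = algebraMap F E (qq o x s c X) := by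
  simp [qq]

lemma bb_map {F : Type} [Field F] [Algebra F E] (o s c : F) (W X : Fin 4 → F) :
    bb (algebraMap F E s) (algebraMap F E c) (algebraMap F E o)
      (fun i => algebraMap F E (W i)) (fun i => algebraMap F E (X i))
      = algebraMap F E (bb s c o W X) := by
  simp [bb]

lemma main_abs {F : Type} [Field F] [Algebra F E] [CharP F 2] [CharP E 2] (w : Val2 E)
    (o x s c : F) (u V : E)
    (S : Setup w (algebraMap F E o) (algebraMap F E x) (algebraMap F E s) (algebraMap F E c) u V)
    (hev : ∀ g : F, g ≠ 0 → Even (w.d1 (algebraMap F E g))) : ¬ Excellent F E := by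
  obtain ⟨lam0, o0, o1⟩ := S.lam
  have inj := (algebraMap F E).injective
  have hkey : ∀ (Y W : Fin 4 → E) (g : F), Y ≠ 0 →
      qq (algebraMap F E o) (algebraMap F E x) (algebraMap F E s) (algebraMap F E c) Y = 0 →
      bb (algebraMap F E s) (algebraMap F E c) (algebraMap F E o) Y W = 0 →
      qq (algebraMap F E o) (algebraMap F E x) (algebraMap F E s) (algebraMap F E c) W
        = algebraMap F E g → g ≠ 0 → False := by
    intro Y W g hY hq hb hW hg
    have h1 := S.key Y W hY hq hb (by rw [hW]; simpa using hg)
    rw [hW] at h1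
    exact (Int.not_even_iff_odd.2 h1) (hev g hg)
  have hkeyF : ∀ (Y W : Fin 4 → F), Y ≠ 0 → qq o x s c Y = 0 → bb s c o Y W = 0 →
      qq o x s c W ≠ 0 → False := by
    intro Y W hY hq hb hW
    refine hkey (fun i => algebraMap F E (Y i)) (fun i => algebraMap F E (W i)) (qq o x s c W)
      ?_ ?_ ?_ ?_ hW
    · intro h
      apply hY
      funext i
      have := congrFun h i
      simpa using this
    · rw [qq_map, hq, map_zero]
    · rw [bb_map, hb, map_zero]
    · rw [qq_map]
  have hanis : (phi o x s c).form.Anisotropic := by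
    intro Y hq
    change Fin 4 → F at Y
    rw [phi_form] at hq
    by_contra hY
    have hY' : Y ≠ 0 := hY
    by_cases h1 : Y 1 = 0
    · refine hkeyF Y ![1, 0, 0, 0] hY' hq ?_ ?_
      · simp [bb, h1]
      · simp [qq]
    · refine hkeyF Y ![(o ^ 2 * s + 1) * Y 3 / Y 1, 0, 1, 0] hY' hq ?_ ?_
      · simp only [bb, Matrix.cons_val_zero, Matrix.cons_val_one, Matrix.cons_val]
        rw [mul_div_cancel₀ _ h1]
        have h2 : (2 : F) = 0 := CharTwo.two_eq_zero
        linear_combination ((o ^ 2 * s + 1) * Y 3) * h2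
      · set t := (o ^ 2 * s + 1) * Y 3 / Y 1
        intro h
        have h2 : (2 : F) = 0 := CharTwo.two_eq_zero
        have ht : t ^ 2 = o * s := by
          simp only [qq, Matrix.cons_val_zero, Matrix.cons_val_one, Matrix.cons_val] at h
          linear_combination h - (o * s) * h2
        have ht' := congrArg (algebraMap F E) ht
        rw [map_pow, map_mul] at ht'
        have t0 : t ≠ 0 := by
          intro h0
          rw [h0, map_zero, zero_pow two_ne_zero] at ht'
          exact mul_ne_zero o0 S.s0 ht'.symm
        have e1 := w.pow1 (algebraMap F E t) (by simpa using t0) 2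
        rw [ht', w.mul1 _ _ o0 S.s0, o1, S.s1] at e1
        obtain ⟨r, hr⟩ := hev t t0
        push_cast at e1
        omega
  intro hex
  obtain ⟨ψ, hψ⟩ := hex _ hanis
  rw [phi_bc] at hψ
  revert hψ
  have hpol : ∀ Y W : Fin 4 → E,
      (phi (algebraMap F E o) (algebraMap F E x) (algebraMap F E s) (algebraMap F E c)).form (Y + W)
      = (phi (algebraMap F E o) (algebraMap F E x) (algebraMap F E s) (algebraMap F E c)).form Y
      + (phi (algebraMap F E o) (algebraMap F E x) (algebraMap F E s) (algebraMap F E c)).form W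
      + bb (algebraMap F E s) (algebraMap F E c) (algebraMap F E o) Y W := by
    intro Y W
    have h1 := phi_form (algebraMap F E o) (algebraMap F E x) (algebraMap F E s) (algebraMap F E c)
    have := qq_add (algebraMap F E o) (algebraMap F E x) (algebraMap F E s) (algebraMap F E c) Y W
    rw [← h1, ← h1, ← h1] at this
    exact this
  apply QF.not_anisoPart _ ψ rfl
  · intro R hR
    change Fin 4 → E at R
    have hR0 : (phi (algebraMap F E o) (algebraMap F E x) (algebraMap F E s)
        (algebraMap F E c)).form R = 0 := by
      have h3 := hR (0 : Fin 4 → E)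
      have h4 : (0 : Fin 4 → E) + R = R := zero_add R
      exact ((congrArg _ h4).symm.trans h3).trans (map_zero _)
    have hb : ∀ A : Fin 4 → E,
        bb (algebraMap F E s) (algebraMap F E c) (algebraMap F E o) A R = 0 := by
      intro A
      have h1 := (hpol A R).symm.trans (hR A)
      rw [hR0, add_zero] at h1
      exact add_eq_left.1 h1
    have r1 : R 1 = 0 := by
      have := hb ![1, 0, 0, 0]
      simpa [bb] using this
    have r3 : R 3 = 0 := by
      have := hb ![0, 0, 1, 0]
      simpa [bb, lam0] using this
    have r0 : R 0 = 0 := by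
      have := hb ![0, 1, 0, 0]
      simpa [bb, r3] using this
    have r2 : R 2 = 0 := by
      have := hb ![0, 0, 0, 1]
      simpa [bb, r1, lam0] using this
    show R = (0 : Fin 4 → E)
    funext i
    fin_cases i
    · exact r0
    · exact r1
    · exact r2
    · exact r3
  · refine ⟨zz (algebraMap F E o) u V, ?_, ?_⟩
    · intro h
      have h3 : (1 : E) = 0 := congrFun h (3 : Fin 4)
      exact one_ne_zero h3
    · rw [phi_form]
      exact qq_zz _ _ _ _ _ _ S.ho S.hu S.hV S.hc
  · intro Y W g hY hq hadd hW hg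
    have hadd' := (hpol Y W).symm.trans hadd
    refine hkey Y W g hY ?_ (add_eq_left.1 hadd') ?_ hg
    · exact (phi_form _ _ _ _ _).symm.trans hq
    · exact (phi_form _ _ _ _ _).symm.trans hW

end final

/-- Embedding of the biquadratic extension. -/
lemma exists_hom {F E O : Type} [Field F] [Field E] [Field O] [Algebra F E] [CharP F 2]
    [CharP E 2] [CharP O 2] (J : F →+* O)
    (a b : F) (u v : E) (hu : u ^ 2 + u = algebraMap F E a) (hv : v ^ 2 + v = algebraMap F E b)
    (hgen : Algebra.adjoin F {u, v} = ⊤) (u' v' : O) (hu' : u' ^ 2 + u' = J a)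
    (hv' : v' ^ 2 + v' = J b) :
    ∃ i : E →+* O, ∀ g, i (algebraMap F E g) = J g := by
  letI : Algebra F O := J.toAlgebra
  have hJ : ∀ g, algebraMap F O g = J g := fun _ => rfl
  have main : ∀ (a : F) (u : E) (u' : O), u ^ 2 + u = algebraMap F E a → u' ^ 2 + u' = J a →
      IsIntegral F u ∧ ((minpoly F u).map (algebraMap F O)).Splits := by
    intro a u u' h h'
    let p : Polynomial F := Polynomial.X ^ 2 + Polynomial.X - Polynomial.C a
    have hp : p.Monic := by
      have : p = Polynomial.X ^ 2 + (Polynomial.X - Polynomial.C a) := by simp only [p]; ring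
      rw [this]
      apply Polynomial.monic_X_pow_add
      rw [Polynomial.degree_X_sub_C]; norm_num
    have hpu : Polynomial.aeval u p = 0 := by simp [p, h]
    have hpm : p.map (algebraMap F O)
        = (Polynomial.X - Polynomial.C u') * (Polynomial.X - Polynomial.C (u' + 1)) := by
      have h2 : (2 : O) = 0 := CharTwo.two_eq_zero
      have h2' : (2 : Polynomial O) = 0 := CharTwo.two_eq_zero
      simp only [p, Polynomial.map_sub, Polynomial.map_add, Polynomial.map_pow, Polynomial.map_X,
        Polynomial.map_C, hJ, ← h', Polynomial.C_add, Polynomial.C_pow, Polynomial.C_1]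
      linear_combination (Polynomial.X * (Polynomial.C u' + 1) - (Polynomial.C u') ^ 2
        - Polynomial.C u') * h2'
    refine ⟨⟨p, hp, hpu⟩, ?_⟩
    have hs : (p.map (algebraMap F O)).Splits := by
      rw [hpm]
      exact (Polynomial.Splits.X_sub_C _).mul (Polynomial.Splits.X_sub_C _)
    exact hs.of_dvd (hp.map _).ne_zero (Polynomial.map_dvd _ (minpoly.dvd F u hpu))
  have htop : IntermediateField.adjoin F ({u, v} : Set E) = ⊤ := by
    rw [eq_top_iff]
    intro t _
    apply IntermediateField.algebra_adjoin_le_adjoin F ({u, v} : Set E)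
    rw [hgen]; trivial
  obtain ⟨f⟩ := IntermediateField.nonempty_algHom_of_adjoin_splits (F := F) (E := E) (K := O)
    (S := {u, v}) (by
      intro t ht
      rcases ht with rfl | rfl
      · exact main a _ u' hu hu'
      · exact main b _ v' hv hv') htop
  exact ⟨f.toRingHom, fun g => f.commutes g⟩

set_option synthInstance.maxHeartbeats 1000000 in
set_option maxHeartbeats 2000000 in
/-- **Corollary 5.4** (Barry–Laghribi). Let `k` be an algebraically closed field of
characteristic 2, `F = k(x, y)`, `a = x` and `b = x⁻²y⁻¹ + 1`. Then the separable
biquadratic extension `F(℘⁻¹(a), ℘⁻¹(b))` of `F` is not excellent. -/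
theorem stmt_18 (k : Type) [Field k] [IsAlgClosed k] [CharP k 2]
    (L : Type) [Field L] [Algebra (RatFunc2 k) L] (u v : L)
    (hu : u ^ 2 + u = algebraMap (RatFunc2 k) L (xV k))
    (hv : v ^ 2 + v = algebraMap (RatFunc2 k) L (bV k))
    (hgen : Algebra.adjoin (RatFunc2 k) {u, v} = ⊤)
    (hdeg : Module.finrank (RatFunc2 k) L = 4) :
    ¬ Excellent (RatFunc2 k) L := by
  haveI cF : CharP (RatFunc2 k) 2 :=
    charP_of_injective_ringHom
      (f := (RatFunc.C : RatFunc k →+* RatFunc2 k).comp (RatFunc.C : k →+* RatFunc k))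
      (RingHom.injective _) 2
  haveI cL : CharP L 2 := charP_of_injective_ringHom (algebraMap (RatFunc2 k) L).injective 2
  haveI cO : CharP (HahnSeries (ℤ ×ₗ ℤ) k) 2 :=
    charP_of_injective_ringHom (f := (HahnSeries.C : k →+* HahnSeries (ℤ ×ₗ ℤ) k))
      (RingHom.injective _) 2
  obtain ⟨J, u', V', hu', hV', x1, x2, s1, s2, hev⟩ := exists_embed k
  obtain ⟨t, ht⟩ : ∃ t : k, t ^ 2 + t + 1 = 0 := by
    obtain ⟨t, ht⟩ := IsAlgClosed.exists_root
      (Polynomial.X ^ 2 + (Polynomial.X + Polynomial.C 1) : Polynomial k) (by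
        have : (Polynomial.X ^ 2 + (Polynomial.X + Polynomial.C 1) : Polynomial k).degree = 2 := by
          compute_degree!
        rw [this]; norm_num)
    refine ⟨t, ?_⟩
    simp [Polynomial.IsRoot] at ht
    linear_combination ht
  set o : RatFunc2 k := RatFunc.C (RatFunc.C t) with hodef
  have ho : o ^ 2 + o + 1 = 0 := by
    rw [hodef, ← map_pow, ← map_pow, ← map_add, ← map_add, ← map_one RatFunc.C,
      ← map_one RatFunc.C, ← map_add, ← map_add, ht, map_zero, map_zero]
  set x := xV k with hx
  set s := x ^ (-2 : ℤ) * (yV k)⁻¹ with hs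
  have hb : bV k = s + 1 := rfl
  have hoJ : J o ^ 2 + J o + 1 = 0 := by
    have := congrArg J ho
    simpa using this
  have hoL : algebraMap _ L o ^ 2 + algebraMap _ L o + 1 = 0 := by
    have := congrArg (algebraMap _ L) ho
    simpa using this
  have h2O : (2 : HahnSeries (ℤ ×ₗ ℤ) k) = 0 := CharTwo.two_eq_zero
  have h2L : (2 : L) = 0 := CharTwo.two_eq_zero
  obtain ⟨i, hi⟩ := exists_hom J x (bV k) u v hu hv hgen u' (V' + J o) hu'.symm (by
    rw [hb, map_add, map_one, hV']
    linear_combination hoJ + (V' * J o - 1) * h2O)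
  have xn : x ≠ 0 := by
    rw [hx, xV]
    exact (map_ne_zero _).2 RatFunc.X_ne_zero
  have sn : s ≠ 0 := mul_ne_zero (zpow_ne_zero _ xn) (inv_ne_zero RatFunc.X_ne_zero)
  refine main_abs ((hahnVal k).comap i) o x s (x / s) u (v + algebraMap _ L o) ?_ ?_
  · refine ⟨hoL, hu, ?_, ?_, ?_, ?_, ?_, ?_, ?_, ?_⟩
    · rw [hb, map_add, map_one] at hv
      linear_combination hv + hoL + (v * algebraMap _ L o) * h2L
    · rw [← map_mul, div_mul_cancel₀ _ sn]
    · exact (map_ne_zero _).2 xn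
    · exact (map_ne_zero _).2 sn
    · change (hahnVal k).d1 (i _) = _
      rw [hi, x1]
    · change (hahnVal k).d2 (i _) = _
      rw [hi, x2]
    · change (hahnVal k).d1 (i _) = _
      rw [hi, s1]
    · change (hahnVal k).d2 (i _) = _
      rw [hi, s2]
  · intro g hg
    change Even ((hahnVal k).d1 (i _))
    rw [hi]
    exact (hev g hg).1

end BL
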